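/- Let h = L²(ℝ, ℂ), let Q be multiplication by x and P = -i d/dx, let m > 0, c ∈ ℝ, α, β ≥ 0, H = (1/(2m))P² + cQ², L₁ = αQ, L₂ = βP, and G = -iH - (1/2)(L₁*L₁ + L₂*L₂) = -iH - (1/2)(α²Q² + β²P²). Then for every f ∈ C_c^∞(ℝ, ℂ): (i) ⟨Qf, Gf⟩ + ⟨Gf, Qf⟩ + ⟨L₁f, Q L₁f⟩ + ⟨L₂f, Q L₂f⟩ = (1/m)⟨f, Pf⟩; and (ii) ⟨Pf, Gf⟩ + ⟨Gf, Pf⟩ + ⟨L₁f, P L₁f⟩ + ⟨L₂f, P L₂f⟩ = -2c⟨f, Qf⟩. -/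

import Mathlib

open MeasureTheory ComplexConjugate

noncomputable section

/-- The position operator `Q f (x) = x f(x)` on functions `ℝ → ℂ`. -/
def Qop (f : ℝ → ℂ) : ℝ → ℂ := fun t => (t : ℂ) * f t

/-- The momentum operator `P f (x) = -i f'(x)` on functions `ℝ → ℂ`. -/
def Pop (f : ℝ → ℂ) : ℝ → ℂ := fun t => -Complex.I * deriv f t

/-- The `L²(ℝ, ℂ)` inner product `⟨f, g⟩ = ∫ conj (f x) * g x dx`, antilinear in the
first variable. -/
def ip (f g : ℝ → ℂ) : ℂ := ∫ t : ℝ, conj (f t) * g t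

/-- The Hamiltonian `H = (1/(2m)) P² + c Q²`. -/
def Hop (m c : ℝ) (f : ℝ → ℂ) : ℝ → ℂ :=
  fun t => (1 / (2 * (m : ℂ))) * Pop (Pop f) t + (c : ℂ) * Qop (Qop f) t

/-- The drift operator `G = -iH - (1/2)(α² Q² + β² P²)`. -/
def Gop (m c α β : ℝ) (f : ℝ → ℂ) : ℝ → ℂ :=
  fun t => -Complex.I * Hop m c f t
    - (1 / 2 : ℂ) * ((α : ℂ) ^ 2 * Qop (Qop f) t + (β : ℂ) ^ 2 * Pop (Pop f) t)

end

/-- `f ∈ C_c^∞(ℝ, ℂ)`. -/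
def IsTestFunction (f : ℝ → ℂ) : Prop :=
  ContDiff ℝ (⊤ : ℕ∞) f ∧ HasCompactSupport f

namespace IsTestFunction

variable {f g : ℝ → ℂ}

theorem mul_left (hf : IsTestFunction f) (hg : ContDiff ℝ (⊤ : ℕ∞) g) :
    IsTestFunction fun t => g t * f t :=
  ⟨hg.mul hf.1, hf.2.mul_left⟩

theorem const_mul (hf : IsTestFunction f) (a : ℂ) : IsTestFunction fun t => a * f t :=
  hf.mul_left contDiff_const

theorem add (hf : IsTestFunction f) (hg : IsTestFunction g) :
    IsTestFunction fun t => f t + g t :=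
  ⟨hf.1.add hg.1, hf.2.add hg.2⟩

theorem sub (hf : IsTestFunction f) (hg : IsTestFunction g) :
    IsTestFunction fun t => f t - g t :=
  ⟨hf.1.sub hg.1, hf.2.sub hg.2⟩

theorem deriv (hf : IsTestFunction f) : IsTestFunction (deriv f) :=
  ⟨(contDiff_infty_iff_deriv.1 hf.1).2, hf.2.deriv⟩

theorem hasDerivAt (hf : IsTestFunction f) (t : ℝ) : HasDerivAt f (_root_.deriv f t) t :=
  (hf.1.differentiable (by simp) t).hasDerivAt

theorem conj_mul (hf : IsTestFunction f) (hg : IsTestFunction g) :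
    IsTestFunction fun t => conj (f t) * g t :=
  hg.mul_left (Complex.conjCLE.contDiff.comp hf.1)

theorem ofReal_mul (hf : IsTestFunction f) : IsTestFunction fun t => (t : ℂ) * f t :=
  hf.mul_left Complex.ofRealCLM.contDiff

theorem Qop (hf : IsTestFunction f) : IsTestFunction (Qop f) :=
  hf.ofReal_mul

theorem Pop (hf : IsTestFunction f) : IsTestFunction (Pop f) :=
  hf.deriv.const_mul _

theorem Hop (hf : IsTestFunction f) (m c : ℝ) : IsTestFunction (Hop m c f) :=
  (hf.Pop.Pop.const_mul _).add (hf.Qop.Qop.const_mul _)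

theorem Gop (hf : IsTestFunction f) (m c α β : ℝ) : IsTestFunction (Gop m c α β f) :=
  ((hf.Hop m c).const_mul _).sub
    (((hf.Qop.Qop.const_mul _).add (hf.Pop.Pop.const_mul _)).const_mul _)

theorem integrable (hf : IsTestFunction f) : Integrable f :=
  hf.1.continuous.integrable_of_hasCompactSupport hf.2

theorem integral_deriv (hf : IsTestFunction f) : ∫ t, _root_.deriv f t = 0 :=
  integral_eq_zero_of_hasDerivAt_of_integrable hf.hasDerivAt hf.deriv.integrable hf.integrable

end IsTestFunction

theorem deriv_Pop (f : ℝ → ℂ) (t : ℝ) : deriv (Pop f) t = -Complex.I * deriv (deriv f) t :=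
  deriv_const_mul_field _

theorem Pop_Pop (f : ℝ → ℂ) (t : ℝ) : Pop (Pop f) t = -deriv (deriv f) t := by
  rw [Pop, deriv_Pop]
  linear_combination deriv (deriv f) t * Complex.I_sq

/-- A sum of four inner products of test functions is a multiple of a fifth one as soon as the
integrands differ by the derivative of a test function. -/
theorem ip_add_eq_of_hasDerivAt {F f₁ g₁ f₂ g₂ f₃ g₃ f₄ g₄ f₅ g₅ : ℝ → ℂ} {k : ℂ}
    (hF : IsTestFunction F)
    (hf₁ : IsTestFunction f₁) (hg₁ : IsTestFunction g₁)
    (hf₂ : IsTestFunction f₂) (hg₂ : IsTestFunction g₂)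
    (hf₃ : IsTestFunction f₃) (hg₃ : IsTestFunction g₃)
    (hf₄ : IsTestFunction f₄) (hg₄ : IsTestFunction g₄)
    (hf₅ : IsTestFunction f₅) (hg₅ : IsTestFunction g₅)
    (h : ∀ t, HasDerivAt F (conj (f₁ t) * g₁ t + conj (f₂ t) * g₂ t + conj (f₃ t) * g₃ t
      + conj (f₄ t) * g₄ t - k * (conj (f₅ t) * g₅ t)) t) :
    ip f₁ g₁ + ip f₂ g₂ + ip f₃ g₃ + ip f₄ g₄ = k * ip f₅ g₅ := by
  have i₁ := (hf₁.conj_mul hg₁).integrable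
  have i₂ := (hf₂.conj_mul hg₂).integrable
  have i₃ := (hf₃.conj_mul hg₃).integrable
  have i₄ := (hf₄.conj_mul hg₄).integrable
  have i₅ := ((hf₅.conj_mul hg₅).const_mul k).integrable
  have key := hF.integral_deriv
  simp only [fun t => (h t).deriv] at key
  rw [integral_sub (((i₁.fun_add i₂).fun_add i₃).fun_add i₄) i₅, sub_eq_zero,
    integral_add ((i₁.fun_add i₂).fun_add i₃) i₄, integral_add (i₁.fun_add i₂) i₃,
    integral_add i₁ i₂, integral_const_mul] at key
  exact key

/-- Ehrenfest-type identities: with `H = (1/(2m))P² + cQ²`, `L₁ = αQ`,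
`L₂ = βP` and `G = -iH - (1/2)(α²Q² + β²P²)`, for every `f ∈ C_c^∞(ℝ, ℂ)`:
(i) `⟨Qf, Gf⟩ + ⟨Gf, Qf⟩ + ⟨L₁f, Q L₁f⟩ + ⟨L₂f, Q L₂f⟩ = (1/m)⟨f, Pf⟩`, and
(ii) `⟨Pf, Gf⟩ + ⟨Gf, Pf⟩ + ⟨L₁f, P L₁f⟩ + ⟨L₂f, P L₂f⟩ = -2c⟨f, Qf⟩`. -/
theorem ehrenfest_identities (m c α β : ℝ) (hm : 0 < m) (hα : 0 ≤ α) (hβ : 0 ≤ β)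
    (f : ℝ → ℂ) (hf : ContDiff ℝ (⊤ : ℕ∞) f) (hsupp : HasCompactSupport f) :
    ip (Qop f) (Gop m c α β f) + ip (Gop m c α β f) (Qop f)
      + ip (fun t => (α : ℂ) * Qop f t) (Qop fun t => (α : ℂ) * Qop f t)
      + ip (fun t => (β : ℂ) * Pop f t) (Qop fun t => (β : ℂ) * Pop f t)
      = (1 / (m : ℂ)) * ip f (Pop f) ∧
    ip (Pop f) (Gop m c α β f) + ip (Gop m c α β f) (Pop f)
      + ip (fun t => (α : ℂ) * Qop f t) (Pop fun t => (α : ℂ) * Qop f t)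
      + ip (fun t => (β : ℂ) * Pop f t) (Pop fun t => (β : ℂ) * Pop f t)
      = -2 * (c : ℂ) * ip f (Qop f) := by
  have tf : IsTestFunction f := ⟨hf, hsupp⟩
  have tQ := tf.Qop
  have tP := tf.Pop
  have tG := tf.Gop m c α β
  have hm' : (m : ℂ) ≠ 0 := by exact_mod_cast hm.ne'
  have dt (t : ℝ) : HasDerivAt (fun s : ℝ => (s : ℂ)) 1 t := Complex.ofRealCLM.hasDerivAt
  have df := tf.hasDerivAt
  have df' := tf.deriv.hasDerivAt
  have dc (t : ℝ) : HasDerivAt (fun s => conj (f s)) (conj (deriv f t)) t := (df t).star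
  have dc' (t : ℝ) : HasDerivAt (fun s => conj (deriv f s)) (conj (deriv (deriv f) t)) t :=
    (df' t).star
  have dQ (t : ℝ) : deriv (Qop f) t = f t + t * deriv f t := by
    change deriv (fun s : ℝ => (s : ℂ) * f s) t = _
    simpa using ((dt t).fun_mul (df t)).deriv
  constructor
  · refine ip_add_eq_of_hasDerivAt
      (F := fun t => Complex.I / (2 * m) *
          (t * (conj (f t) * deriv f t - conj (deriv f t) * f t) + conj (f t) * f t)
        + β ^ 2 / 2 * (t * (conj (f t) * deriv f t + conj (deriv f t) * f t) - conj (f t) * f t))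
      ?_ tQ tG tG tQ (tQ.const_mul _) (tQ.const_mul _).Qop (tP.const_mul _) (tP.const_mul _).Qop
      tf tP fun t => ?_
    · have h₀ := tf.conj_mul tf
      have h₁ := tf.conj_mul tf.deriv
      have h₂ := tf.deriv.conj_mul tf
      exact (((h₁.sub h₂).ofReal_mul.add h₀).const_mul _).add
        (((h₁.add h₂).ofReal_mul.sub h₀).const_mul _)
    · have h₀ := (dc t).fun_mul (df t)
      have h₁ := (dc t).fun_mul (df' t)
      have h₂ := (dc' t).fun_mul (df t)
      refine (((((dt t).fun_mul (h₁.fun_sub h₂)).fun_add h₀).const_mul _).fun_add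
        ((((dt t).fun_mul (h₁.fun_add h₂)).fun_sub h₀).const_mul _)).congr_deriv ?_
      simp only [Gop, Hop, Pop_Pop]
      simp only [Qop, Pop, map_add, map_sub, map_mul, map_neg, map_div₀,
        map_pow, map_one, map_ofNat, Complex.conj_I, Complex.conj_ofReal]
      field_simp
      ring_nf
      simp only [Complex.I_sq]
      ring
  · refine ip_add_eq_of_hasDerivAt
      (F := fun t => (-1 / (2 * m) - Complex.I * β ^ 2 / 2) * (conj (deriv f t) * deriv f t)
        + (c - Complex.I * α ^ 2 / 2) * (t * (t * (conj (f t) * f t))))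
      ?_ tP tG tG tP (tQ.const_mul _) (tQ.const_mul _).Pop (tP.const_mul _) (tP.const_mul _).Pop
      tf tQ fun t => ?_
    · exact ((tf.deriv.conj_mul tf.deriv).const_mul _).add
        ((tf.conj_mul tf).ofReal_mul.ofReal_mul.const_mul _)
    · refine ((((dc' t).fun_mul (df' t)).const_mul _).fun_add
        (((dt t).fun_mul ((dt t).fun_mul ((dc t).fun_mul (df t)))).const_mul _)).congr_deriv ?_
      have hPQ : Pop (fun s => (α : ℂ) * Qop f s) t
          = -Complex.I * (α * (f t + t * deriv f t)) := by
        simp [Pop, dQ]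
      have hPP : Pop (fun s => (β : ℂ) * Pop f s) t = -β * deriv (deriv f) t := by
        rw [Pop, deriv_const_mul_field, deriv_Pop]
        linear_combination β * deriv (deriv f) t * Complex.I_sq
      simp only [hPQ, hPP, Gop, Hop, Pop_Pop]
      simp only [Qop, Pop, map_add, map_sub, map_mul, map_neg, map_div₀,
        map_pow, map_one, map_ofNat, Complex.conj_I, Complex.conj_ofReal]
      field_simp
      ring_nf
      simp only [Complex.I_sq]
      ring
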